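/- arXiv:1411.4418 — 2 statements merged into one kernel-verified Lean document; each statement's English description precedes it below -/
import Mathlib

section
/- Let R be a ring and M a left R-module. Then Cogen(M) equals the class of all left R-modules X with Ext^1_R(X, M) = 0 if and only if M is a classical cotilting module, i.e.: (i) M has injective dimension at most 1; (ii) Ext^1_R(M^I, M) = 0 for every direct product M^I of copies of M; and (iii) there is a short exact sequence 0 → M' → M'' → Q → 0 of left R-modules where Q is an injective cogenerator of the category of left R-modules and M', M'' are direct summands of direct products of copies of M. -/
open CategoryTheory

universe u

noncomputable section

variable (R : Type u) [Ring R]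

/-- `Ext^n_R(M, N) = 0`. -/
def ExtVanish (M N : ModuleCat.{u} R) (n : ℕ) : Prop :=
  Subsingleton (((Ext ℤ (ModuleCat.{u} R) n).obj (Opposite.op M)).obj N)

/-- `N ∈ Prod M`: `N` is a direct summand of a direct product of copies of `M`. -/
def InProd (M N : ModuleCat.{u} R) : Prop :=
  ∃ (ι : Type u) (s : N ⟶ ModuleCat.of R (ι → M)) (r : ModuleCat.of R (ι → M) ⟶ N),
    s ≫ r = 𝟙 N

/-- `X ∈ Cogen(M)`: `X` embeds into a direct product of copies of `M`. -/
def InCogen (M X : ModuleCat.{u} R) : Prop :=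
  ∃ (ι : Type u) (f : X ⟶ ModuleCat.of R (ι → M)), Function.Injective f

/-- `Q` is an injective cogenerator of the category of left `R`-modules. -/
def IsInjectiveCogenerator (Q : ModuleCat.{u} R) : Prop :=
  Injective Q ∧ ∀ X : ModuleCat.{u} R, ∃ (ι : Type u) (f : X ⟶ ModuleCat.of R (ι → Q)),
    Function.Injective f

variable {R}

open Abelian

lemma linearYonedaObj_exactAt_iff {X : ModuleCat.{u} R} (P : ProjectiveResolution X)
    (N : ModuleCat.{u} R) (n : ℕ) :
    (P.complex.linearYonedaObj ℤ N).ExactAt (n + 1) ↔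
      ∀ f : P.complex.X (n + 1) ⟶ N, P.complex.d (n + 2) (n + 1) ≫ f = 0 →
        ∃ g : P.complex.X n ⟶ N, P.complex.d (n + 1) n ≫ g = f := by
  rw [HomologicalComplex.exactAt_iff' _ n (n + 1) (n + 2) (by simp) (by simp),
    ShortComplex.moduleCat_exact_iff]
  rfl

/-- The derived functor `Ext` and the groups of morphisms in the derived category vanish
simultaneously. -/
lemma extVanish_succ_iff (X N : ModuleCat.{u} R) (n : ℕ) :
    ExtVanish R X N (n + 1) ↔ Subsingleton (Abelian.Ext.{u} X N (n + 1)) := by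
  let P := projectiveResolution X
  rw [ExtVanish, ← ModuleCat.isZero_iff_subsingleton, (P.isoExt (R := ℤ) (n + 1) N).isZero_iff,
    ← HomologicalComplex.exactAt_iff_isZero_homology, linearYonedaObj_exactAt_iff]
  constructor
  · refine fun h ↦ subsingleton_of_forall_eq 0 fun α ↦ ?_
    obtain ⟨f, hf, rfl⟩ := P.extMk_surjective α (n + 2) rfl
    exact (P.extMk_eq_zero_iff f _ rfl hf n rfl).2 (h f hf)
  · intro h f hf
    exact (P.extMk_eq_zero_iff f _ rfl hf n rfl).1 (Subsingleton.elim _ _)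

/-- A short exact sequence of modules as a short exact complex. -/
lemma shortExact_of_function_exact {A B X : ModuleCat.{u} R} {i : A ⟶ B} {p : B ⟶ X}
    (hi : Function.Injective i) (hp : Function.Surjective p) (hip : Function.Exact i p) :
    (ShortComplex.mk i p (by ext x; exact hip.apply_apply_eq_zero x)).ShortExact where
  exact := (ShortComplex.ShortExact.moduleCat_exact_iff_function_exact _).2 hip
  mono_f := (ModuleCat.mono_iff_injective i).2 hi
  epi_g := (ModuleCat.epi_iff_surjective p).2 hp

lemma extClass_comp_mk₀_comp {S : ShortComplex (ModuleCat.{u} R)} (hS : S.ShortExact)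
    {N : ModuleCat.{u} R} (g : S.X₂ ⟶ N) :
    hS.extClass.comp (Ext.mk₀ (S.f ≫ g)) (add_zero 1) = 0 := by
  rw [← Ext.mk₀_comp_mk₀, ← Ext.comp_assoc_of_second_deg_zero, hS.extClass_comp, Ext.zero_comp]

/-- Vanishing of `Ext¹` means that morphisms extend along monomorphisms with the given cokernel. -/
lemma extVanish_one_iff_extends (X N : ModuleCat.{u} R) :
    ExtVanish R X N 1 ↔ ∀ (A B : ModuleCat.{u} R) (i : A ⟶ B) (p : B ⟶ X),
      Function.Injective i → Function.Surjective p → Function.Exact i p →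
        ∀ f : A ⟶ N, ∃ g : B ⟶ N, i ≫ g = f := by
  rw [extVanish_succ_iff]
  constructor
  · intro h A B i p hi hp hip f
    have hS := shortExact_of_function_exact hi hp hip
    obtain ⟨g, hg⟩ := Ext.contravariant_sequence_exact₁ hS N (Ext.mk₀ f) rfl
      (Subsingleton.elim (α := Abelian.Ext.{u} X N 1) _ _)
    obtain ⟨g, rfl⟩ := (Ext.mk₀_bijective _ _).2 g
    exact ⟨g, (Ext.mk₀_bijective _ _).1 (by simpa using hg)⟩
  · refine fun h ↦ subsingleton_of_forall_eq 0 fun α ↦ ?_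
    have hS := X.shortExact_projectiveShortComplex
    obtain ⟨f, rfl⟩ := precomp_extClass_surjective_of_projective_X₂ N hS 0 α
    obtain ⟨f, rfl⟩ := (Ext.mk₀_bijective _ _).2 f
    obtain ⟨g, rfl⟩ := h _ _ _ _ hS.moduleCat_injective_f hS.moduleCat_surjective_g
      ((ShortComplex.ShortExact.moduleCat_exact_iff_function_exact _).1 hS.exact) f
    exact extClass_comp_mk₀_comp hS g

lemma ExtVanish.of_inProd {M N X : ModuleCat.{u} R} (hX : ExtVanish R X M 1)
    (hN : InProd R M N) : ExtVanish R X N 1 := by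
  rw [extVanish_one_iff_extends] at hX ⊢
  obtain ⟨ι, s, r, hsr⟩ := hN
  intro A B i p hi hp hip f
  choose g hg using fun k : ι ↦
    hX A B i p hi hp hip (f ≫ s ≫ ModuleCat.ofHom (LinearMap.proj k))
  refine ⟨ModuleCat.ofHom (LinearMap.pi fun k ↦ (g k).hom) ≫ r, ?_⟩
  have h : i ≫ ModuleCat.ofHom (LinearMap.pi fun k ↦ (g k).hom) = f ≫ s := by
    ext x k
    exact ConcreteCategory.congr_hom (hg k) x
  rw [← Category.assoc, h, Category.assoc, hsr, Category.comp_id]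

lemma inProd_pi (M : ModuleCat.{u} R) (ι : Type u) : InProd R M (ModuleCat.of R (ι → M)) :=
  ⟨ι, 𝟙 _, 𝟙 _, Category.comp_id _⟩

lemma inCogen_pi (M : ModuleCat.{u} R) (ι : Type u) : InCogen R M (ModuleCat.of R (ι → M)) :=
  ⟨ι, 𝟙 _, Function.injective_id⟩

lemma InCogen.of_injective {M X Y : ModuleCat.{u} R} (hY : InCogen R M Y) (f : X ⟶ Y)
    (hf : Function.Injective f) : InCogen R M X := by
  obtain ⟨ι, g, hg⟩ := hY
  exact ⟨ι, f ≫ g, by simpa using hg.comp hf⟩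

lemma InCogen.prod {M X Y : ModuleCat.{u} R} (hX : InCogen R M X) (hY : InCogen R M Y) :
    InCogen R M (ModuleCat.of R (X × Y)) := by
  obtain ⟨ι, f, hf⟩ := hX
  obtain ⟨κ, g, hg⟩ := hY
  refine ⟨ι ⊕ κ, ModuleCat.ofHom (LinearMap.pi (Sum.elim
    (fun i ↦ LinearMap.proj i ∘ₗ f.hom ∘ₗ LinearMap.fst R X Y)
    (fun k ↦ LinearMap.proj k ∘ₗ g.hom ∘ₗ LinearMap.snd R X Y))), ?_⟩
  intro a b hab
  refine Prod.ext (hf (funext fun i ↦ ?_)) (hg (funext fun k ↦ ?_))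
  · exact congrFun hab (Sum.inl i)
  · exact congrFun hab (Sum.inr k)

/-- A module on which the morphisms to `M` separate points lies in `Cogen(M)`, through the
evaluation map. -/
lemma InCogen.of_separating {M X : ModuleCat.{u} R}
    (h : ∀ x : X, x ≠ 0 → ∃ f : X ⟶ M, f x ≠ 0) : InCogen R M X := by
  refine ⟨X ⟶ M, ModuleCat.ofHom (LinearMap.pi fun f ↦ f.hom), ?_⟩
  rw [injective_iff_map_eq_zero]
  intro x hx
  by_contra hne
  obtain ⟨f, hf⟩ := h x hne
  exact hf (congrFun hx f)

lemma InCogen.exists_hom_ne_zero {M X : ModuleCat.{u} R} (h : InCogen R M X) {x : X}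
    (hx : x ≠ 0) : ∃ f : X ⟶ M, f x ≠ 0 := by
  obtain ⟨ι, f, hf⟩ := h
  obtain ⟨i, hi⟩ := Function.ne_iff.1 ((map_ne_zero_iff f.hom hf).2 hx)
  exact ⟨f ≫ ModuleCat.ofHom (LinearMap.proj i), hi⟩

lemma InProd.inCogen {M N : ModuleCat.{u} R} (h : InProd R M N) : InCogen R M N := by
  obtain ⟨ι, s, r, hsr⟩ := h
  exact ⟨ι, s, Function.LeftInverse.injective (g := r) fun x ↦ ConcreteCategory.congr_hom hsr x⟩

/-- If `Ext¹(B, M) = 0` and every morphism `A ⟶ M` extends to `B`, then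
`Ext¹(B / A, M) = 0`. -/
lemma extVanish_one_coker {M A B C : ModuleCat.{u} R} {i : A ⟶ B} {p : B ⟶ C}
    (hi : Function.Injective i) (hp : Function.Surjective p) (hip : Function.Exact i p)
    (hB : ExtVanish R B M 1) (hext : ∀ f : A ⟶ M, ∃ g : B ⟶ M, i ≫ g = f) :
    ExtVanish R C M 1 := by
  rw [extVanish_succ_iff] at hB ⊢
  have hS := shortExact_of_function_exact hi hp hip
  refine subsingleton_of_forall_eq 0 fun α ↦ ?_
  obtain ⟨f, rfl⟩ := Ext.contravariant_sequence_exact₃ hS M α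
    (Subsingleton.elim (α := Abelian.Ext.{u} B M 1) _ _) (n₀ := 0) rfl
  obtain ⟨f, rfl⟩ := (Ext.mk₀_bijective _ _).2 f
  obtain ⟨g, rfl⟩ := hext f
  exact extClass_comp_mk₀_comp hS g

/-- The universal embedding of a module of `Cogen(M)` into a power of `M`. -/
lemma InCogen.exists_universal {M X : ModuleCat.{u} R} (h : InCogen R M X) :
    ∃ (ι : Type u) (C : ModuleCat.{u} R) (i : X ⟶ ModuleCat.of R (ι → M))
      (p : ModuleCat.of R (ι → M) ⟶ C), Function.Injective i ∧ Function.Surjective p ∧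
      Function.Exact i p ∧ ∀ f : X ⟶ M, ∃ g : ModuleCat.of R (ι → M) ⟶ M, i ≫ g = f := by
  let i : X →ₗ[R] ((X ⟶ M) → M) := LinearMap.pi fun f ↦ f.hom
  refine ⟨X ⟶ M, ModuleCat.of R (((X ⟶ M) → M) ⧸ LinearMap.range i), ModuleCat.ofHom i,
    ModuleCat.ofHom (LinearMap.range i).mkQ, ?_, Submodule.mkQ_surjective _,
    LinearMap.exact_map_mkQ_range i, fun f ↦ ⟨ModuleCat.ofHom (LinearMap.proj f), rfl⟩⟩
  refine (injective_iff_map_eq_zero i).2 fun x hx ↦ ?_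
  by_contra hne
  obtain ⟨f, hf⟩ := h.exists_hom_ne_zero hne
  exact hf (congrFun hx f)

variable (R) in
lemma exists_isInjectiveCogenerator : ∃ Q : ModuleCat.{u} R, IsInjectiveCogenerator R Q := by
  obtain ⟨Q, hQ, hsep⟩ := has_injective_coseparator _ (ModuleCat.isSeparator.{u} R)
  refine ⟨Q, hQ, fun X ↦ InCogen.of_separating fun x hx ↦ ?_⟩
  by_contra! h
  refine hx ?_
  have h0 : ModuleCat.ofHom (LinearMap.toSpanSingleton R X x) = 0 := by
    refine hsep.def _ _ fun f ↦ ?_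
    ext
    simp [h f]
  simpa using ConcreteCategory.congr_hom h0 (1 : R)

/-- The pushout of a short exact sequence `0 → K → F → Q → 0` along `u : K ⟶ P`, presented as a
quotient of `P × F`. -/
lemma exists_pushout_of_exact {K F P Q : ModuleCat.{u} R} {j : K ⟶ F} {q : F ⟶ Q} (u : K ⟶ P)
    (hj : Function.Injective j) (hq : Function.Surjective q) (hjq : Function.Exact j q) :
    ∃ (N : ModuleCat.{u} R) (k : K ⟶ ModuleCat.of R (P × F)) (π : ModuleCat.of R (P × F) ⟶ N)
      (f : P ⟶ N) (g : N ⟶ Q), Function.Injective k ∧ Function.Surjective π ∧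
      Function.Exact k π ∧ k ≫ ModuleCat.ofHom (LinearMap.fst R P F) = u ∧
      Function.Injective f ∧ Function.Surjective g ∧ Function.Exact f g := by
  let k : K →ₗ[R] P × F := u.hom.prod j.hom
  refine ⟨ModuleCat.of R ((P × F) ⧸ LinearMap.range k), ModuleCat.ofHom k,
    ModuleCat.ofHom (LinearMap.range k).mkQ,
    ModuleCat.ofHom ((LinearMap.range k).mkQ ∘ₗ LinearMap.inl R P F),
    ModuleCat.ofHom ((LinearMap.range k).liftQ (q.hom ∘ₗ LinearMap.snd R P F) ?_),
    fun x y h ↦ hj (congrArg Prod.snd h), Submodule.mkQ_surjective _,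
    LinearMap.exact_map_mkQ_range k, rfl, ?_, fun y ↦ ?_, fun y ↦ ⟨?_, ?_⟩⟩
  · rintro _ ⟨x, rfl⟩
    exact hjq.apply_apply_eq_zero x
  · refine (injective_iff_map_eq_zero (ModuleCat.Hom.hom _)).2 fun a ha ↦ ?_
    obtain ⟨x, hx⟩ := (Submodule.Quotient.mk_eq_zero _).1 ha
    obtain rfl : x = 0 := hj ((congrArg Prod.snd hx).trans (map_zero j.hom).symm)
    exact (congrArg Prod.fst hx).symm.trans (map_zero u.hom)
  · obtain ⟨b, rfl⟩ := hq y
    exact ⟨Submodule.Quotient.mk (0, b), rfl⟩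
  · intro hy
    obtain ⟨⟨a, b⟩, rfl⟩ := Submodule.Quotient.mk_surjective _ y
    obtain ⟨x, rfl⟩ := (hjq b).1 hy
    refine ⟨a - u x, (Submodule.Quotient.eq _).2 ⟨-x, Prod.ext ?_ ?_⟩⟩
    · exact (map_neg u.hom x).trans (by simp)
    · exact (map_neg j.hom x).trans (by simp)
  · rintro ⟨a, rfl⟩
    exact map_zero q.hom

section Cotilting

variable {M : ModuleCat.{u} R}

lemma ExtVanish.of_inCogen (hid : ∀ X : ModuleCat.{u} R, ExtVanish R X M 2)
    (hpow : ∀ ι : Type u, ExtVanish R (ModuleCat.of R (ι → M)) M 1) {X : ModuleCat.{u} R}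
    (hX : InCogen R M X) : ExtVanish R X M 1 := by
  obtain ⟨ι, C, i, p, hi, hp, hip, -⟩ := hX.exists_universal
  have hS := shortExact_of_function_exact hi hp hip
  have h₁ := hpow ι
  have h₂ := hid C
  rw [extVanish_succ_iff] at h₁ h₂ ⊢
  refine subsingleton_of_forall_eq 0 fun α ↦ ?_
  obtain ⟨β, rfl⟩ := Ext.contravariant_sequence_exact₁ hS M α (n₁ := 2) rfl
    (Subsingleton.elim (α := Abelian.Ext.{u} C M 2) _ _)
  rw [Subsingleton.elim (α := Abelian.Ext.{u} (ModuleCat.of R (ι → M)) M 1) β 0, Ext.comp_zero]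

lemma InCogen.of_extVanish {Q M' M'' : ModuleCat.{u} R} {f : M' ⟶ M''} {g : M'' ⟶ Q}
    (hQ : IsInjectiveCogenerator R Q) (hM' : InProd R M M') (hM'' : InProd R M M'')
    (hf : Function.Injective f) (hg : Function.Surjective g) (hfg : Function.Exact f g)
    {X : ModuleCat.{u} R} (hX : ExtVanish R X M 1) : InCogen R M X := by
  have hX' := hX.of_inProd hM'
  rw [extVanish_succ_iff] at hX'
  have hS := shortExact_of_function_exact hf hg hfg
  refine InCogen.of_separating fun x hx ↦ ?_
  obtain ⟨q, hq⟩ := InCogen.exists_hom_ne_zero (hQ.2 X) hx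
  obtain ⟨l, hl⟩ := Ext.covariant_sequence_exact₃ X hS (Ext.mk₀ q) (n₁ := 1) rfl
    (Subsingleton.elim (α := Abelian.Ext.{u} X M' 1) _ _)
  obtain ⟨l, rfl⟩ := (Ext.mk₀_bijective _ _).2 l
  obtain rfl : l ≫ g = q := (Ext.mk₀_bijective _ _).1 (by simpa using hl)
  have hlx : l x ≠ 0 := fun h0 ↦ hq (by simp [h0])
  obtain ⟨h, hh⟩ := hM''.inCogen.exists_hom_ne_zero hlx
  exact ⟨l ≫ h, hh⟩

lemma inCogen_of_projective
    (hM : ∀ X : ModuleCat.{u} R, InCogen R M X ↔ ExtVanish R X M 1)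
    (F : ModuleCat.{u} R) [Projective F] : InCogen R M F :=
  (hM F).2 ((extVanish_succ_iff F M 0).2 (Ext.subsingleton_of_projective F M 0))

lemma extVanish_add_two
    (hM : ∀ X : ModuleCat.{u} R, InCogen R M X ↔ ExtVanish R X M 1)
    (n : ℕ) (X : ModuleCat.{u} R) : ExtVanish R X M (n + 2) := by
  rw [extVanish_succ_iff]
  have hS := X.shortExact_projectiveShortComplex
  have hK : ExtVanish R X.projectiveShortComplex.X₁ M (n + 1) := by
    cases n with
    | zero =>
      exact (hM _).1 ((inCogen_of_projective hM X.projectiveShortComplex.X₂).of_injective _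
        hS.moduleCat_injective_f)
    | succ n => exact extVanish_add_two hM n _
  rw [extVanish_succ_iff] at hK
  exact (precomp_extClass_surjective_of_projective_X₂ M hS (n + 1)).subsingleton

lemma exists_exact_inProd
    (hM : ∀ X : ModuleCat.{u} R, InCogen R M X ↔ ExtVanish R X M 1) :
    ∃ (Q M' M'' : ModuleCat.{u} R) (f : M' ⟶ M'') (g : M'' ⟶ Q),
      IsInjectiveCogenerator R Q ∧ InProd R M M' ∧ InProd R M M'' ∧
      Function.Injective f ∧ Function.Surjective g ∧ Function.Exact f g := by
  obtain ⟨Q, hQ⟩ := exists_isInjectiveCogenerator R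
  have hS := Q.shortExact_projectiveShortComplex
  have hF := inCogen_of_projective hM Q.projectiveShortComplex.X₂
  obtain ⟨ι, -, u, -, -, -, -, hext⟩ :=
    (hF.of_injective _ hS.moduleCat_injective_f).exists_universal
  obtain ⟨N, k, π, f, g, hk, hπ, hkπ, rfl, hf, hg, hfg⟩ := exists_pushout_of_exact u
    hS.moduleCat_injective_f hS.moduleCat_surjective_g
    ((ShortComplex.ShortExact.moduleCat_exact_iff_function_exact _).1 hS.exact)
  have hN : ExtVanish R N M 1 := by
    refine extVanish_one_coker hk hπ hkπ ((hM _).1 ((inCogen_pi M ι).prod hF)) fun l ↦ ?_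
    obtain ⟨h, rfl⟩ := hext l
    exact ⟨_, (Category.assoc _ _ _).symm⟩
  obtain ⟨κ, D, i, p, hi, hp, hip, hiext⟩ := ((hM N).2 hN).exists_universal
  have hD : ExtVanish R D M 1 :=
    extVanish_one_coker hi hp hip ((hM _).1 (inCogen_pi M κ)) hiext
  have hDN : ExtVanish R D N 1 := by
    have hP := hD.of_inProd (inProd_pi M ι)
    rw [extVanish_succ_iff] at hP ⊢
    have := hQ.1
    refine subsingleton_of_forall_eq 0 fun α ↦ ?_
    obtain ⟨β, rfl⟩ := Ext.covariant_sequence_exact₂ D (shortExact_of_function_exact hf hg hfg) α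
      (Ext.eq_zero_of_injective (I := Q) _)
    rw [Subsingleton.elim (α := Abelian.Ext.{u} D (ModuleCat.of R (ι → M)) 1) β 0, Ext.zero_comp]
  obtain ⟨r, hr⟩ := (extVanish_one_iff_extends D N).1 hDN _ _ i p hi hp hip (𝟙 N)
  exact ⟨Q, _, N, f, g, hQ, inProd_pi M ι, ⟨κ, i, r, hr⟩, hf, hg, hfg⟩

end Cotilting

variable (R)

/-- For a ring `R` and a left `R`-module `M`, the class `Cogen(M)` coincides
with `Ker Ext¹_R(-, M)` if and only if `M` is a classical cotilting module, i.e.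
(i) `M` has injective dimension at most `1` (equivalently, `Ext^i_R(-, M) = 0` for all `i > 1`);
(ii) `Ext¹_R(M^I, M) = 0` for every direct product `M^I` of copies of `M`; and
(iii) there is a short exact sequence `0 → M' → M'' → Q → 0` with `Q` an injective cogenerator
and `M', M'' ∈ Prod M`. -/
theorem cogen_eq_ker_ext_iff_classical_cotilting (M : ModuleCat.{u} R) :
    (∀ X : ModuleCat.{u} R, InCogen R M X ↔ ExtVanish R X M 1) ↔
      ((∀ (X : ModuleCat.{u} R) (i : ℕ), 1 < i → ExtVanish R X M i) ∧
        (∀ ι : Type u, ExtVanish R (ModuleCat.of R (ι → M)) M 1) ∧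
        (∃ (Q M' M'' : ModuleCat.{u} R) (f : M' ⟶ M'') (g : M'' ⟶ Q),
          IsInjectiveCogenerator R Q ∧ InProd R M M' ∧ InProd R M M'' ∧
          Function.Injective f ∧ Function.Surjective g ∧ Function.Exact f g)) := by
  constructor
  · intro hM
    refine ⟨fun X i hi ↦ ?_, fun ι ↦ (hM _).1 (inCogen_pi M ι), exists_exact_inProd hM⟩
    obtain ⟨n, rfl⟩ := Nat.exists_eq_add_of_le' hi
    exact extVanish_add_two hM n X
  · rintro ⟨hid, hpow, Q, M', M'', f, g, hQ, hM', hM'', hf, hg, hfg⟩ X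
    exact ⟨ExtVanish.of_inCogen (fun Y ↦ hid Y 2 one_lt_two) hpow,
      InCogen.of_extVanish hQ hM' hM'' hf hg hfg⟩
end
end

section
/- Let R be a ring and T a finitely generated left R-module of projective dimension at most 1 such that Gen(T) is contained in the class of modules X with Ext^1_R(T, X) = 0, and such that the only left R-module X with Hom_R(T, X) = 0 and Ext^1_R(T, X) = 0 is X = 0. Then Gen(T) equals the class of all left R-modules X with Ext^1_R(T, X) = 0; that is, T is a tilting module. -/
open CategoryTheory

universe u

noncomputable section

variable (R : Type u) [Ring R]

/-- `N ∈ Add M`: `N` is a direct summand of a direct sum of copies of `M`. -/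
def InAdd (M N : ModuleCat.{u} R) : Prop :=
  ∃ (ι : Type u) (s : N ⟶ ModuleCat.of R (ι →₀ M)) (r : ModuleCat.of R (ι →₀ M) ⟶ N),
    s ≫ r = 𝟙 N

/-- `X ∈ Gen(M)`: `X` is an epimorphic image of some member of `Add M`. -/
def InGen (M X : ModuleCat.{u} R) : Prop :=
  ∃ (N : ModuleCat.{u} R) (f : N ⟶ X), InAdd R M N ∧ Function.Surjective f

/-- Vanishing of `Extⁿ⁺¹` says that every cocycle on a projective resolution is a coboundary. -/
lemma extVanish_succ_iff_s3 {T : ModuleCat.{u} R} (P : ProjectiveResolution T)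
    (Y : ModuleCat.{u} R) (n : ℕ) :
    ExtVanish R T Y (n + 1) ↔
      ∀ f : P.complex.X (n + 1) ⟶ Y, P.complex.d (n + 2) (n + 1) ≫ f = 0 →
        ∃ g : P.complex.X n ⟶ Y, P.complex.d (n + 1) n ≫ g = f := by
  rw [ExtVanish, ← ModuleCat.isZero_iff_subsingleton, (P.isoExt (R := ℤ) (n + 1) Y).isZero_iff,
    ← HomologicalComplex.exactAt_iff_isZero_homology,
    HomologicalComplex.exactAt_iff' _ n (n + 1) (n + 2) (by simp) (by simp),
    ShortComplex.moduleCat_exact_iff]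
  rfl

namespace CategoryTheory.ShortComplex.ShortExact

variable {R}
variable {T : ModuleCat.{u} R} {S : ShortComplex (ModuleCat.{u} R)} (hS : S.ShortExact)
include hS

lemma extVanish_one_right (h₂ : ExtVanish R T S.X₂ 1) (h₁ : ExtVanish R T S.X₁ 2) :
    ExtVanish R T S.X₃ 1 := by
  let P := projectiveResolution T
  rw [extVanish_succ_iff_s3 R P] at *
  have := hS.mono_f
  have := hS.epi_g
  intro f hf
  let f' := Projective.factorThru f S.g
  have hf' : f' ≫ S.g = f := Projective.factorThru_comp f S.g
  let c := hS.exact.lift (P.complex.d 2 1 ≫ f') (by rw [Category.assoc, hf', hf])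
  have hc : c ≫ S.f = P.complex.d 2 1 ≫ f' := hS.exact.lift_f _ _
  obtain ⟨g, hg⟩ := h₁ c (by rw [← cancel_mono S.f, Category.assoc, hc]; simp)
  obtain ⟨h, hh⟩ := h₂ (f' - g ≫ S.f) (by
    rw [Preadditive.comp_sub, ← hc, ← hg, Category.assoc, sub_self])
  refine ⟨h ≫ S.g, ?_⟩
  rw [← Category.assoc, hh, Preadditive.sub_comp, Category.assoc, S.zero, hf']
  simp

lemma exists_lift_of_extVanish_one (h₁ : ExtVanish R T S.X₁ 1) (f : T ⟶ S.X₃) :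
    ∃ f' : T ⟶ S.X₂, f' ≫ S.g = f := by
  let P := projectiveResolution T
  rw [extVanish_succ_iff_s3 R P] at h₁
  have := hS.mono_f
  have := hS.epi_g
  let p : P.complex.X 0 ⟶ T := P.π.f 0
  have hp : P.complex.d 1 0 ≫ p = 0 := P.complex_d_comp_π_f_zero
  let h := Projective.factorThru (p ≫ f) S.g
  have hh : h ≫ S.g = p ≫ f := Projective.factorThru_comp _ _
  let c := hS.exact.lift (P.complex.d 1 0 ≫ h) (by
    rw [Category.assoc, hh, ← Category.assoc, hp, Limits.zero_comp])
  have hc : c ≫ S.f = P.complex.d 1 0 ≫ h := hS.exact.lift_f _ _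
  obtain ⟨g, hg⟩ := h₁ c (by rw [← cancel_mono S.f, Category.assoc, hc]; simp)
  have hz : P.complex.d 1 0 ≫ (h - g ≫ S.f) = 0 := by
    rw [Preadditive.comp_sub, ← hc, ← hg, Category.assoc, sub_self]
  obtain ⟨f', hf'⟩ : ∃ f' : T ⟶ S.X₂, p ≫ f' = h - g ≫ S.f :=
    have ⟨f', hf'⟩ := Limits.CokernelCofork.IsColimit.desc' P.isColimitCokernelCofork _ hz
    ⟨f', hf'⟩
  have : Epi p := inferInstanceAs (Epi (P.π.f 0))
  refine ⟨f', ?_⟩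
  rw [← cancel_epi p, ← Category.assoc, hf', Preadditive.sub_comp, Category.assoc, S.zero, hh]
  simp

end CategoryTheory.ShortComplex.ShortExact

/-- The trace of `T` in `X`, i.e. the sum of the images of all maps `T ⟶ X`. -/
def traceSubmodule (T X : ModuleCat.{u} R) : Submodule R X :=
  LinearMap.range (Finsupp.lsum ℕ fun f : T ⟶ X => f.hom)

variable {R}

lemma hom_apply_mem_traceSubmodule {T X : ModuleCat.{u} R} (f : T ⟶ X) (t : T) :
    f t ∈ traceSubmodule R T X :=
  ⟨Finsupp.single f t, by simp⟩

lemma inGen_traceSubmodule (T X : ModuleCat.{u} R) :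
    InGen R T (ModuleCat.of R (traceSubmodule R T X)) :=
  ⟨ModuleCat.of R ((T ⟶ X) →₀ T),
    ModuleCat.ofHom (LinearMap.rangeRestrict (Finsupp.lsum ℕ fun f : T ⟶ X => f.hom)),
    ⟨T ⟶ X, 𝟙 _, 𝟙 _, Category.comp_id _⟩, LinearMap.surjective_rangeRestrict _⟩

lemma InGen.of_surjective {T X Y : ModuleCat.{u} R} (h : InGen R T X) (f : X ⟶ Y)
    (hf : Function.Surjective f) : InGen R T Y := by
  obtain ⟨N, g, hN, hg⟩ := h
  exact ⟨N, g ≫ f, hN, by simpa using hf.comp hg⟩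

/-- The short complex `N → X → X ⧸ N` attached to a submodule. -/
abbrev submoduleShortComplex {X : ModuleCat.{u} R} (N : Submodule R X) :
    ShortComplex (ModuleCat.{u} R) :=
  ShortComplex.mk (ModuleCat.ofHom N.subtype) (ModuleCat.ofHom N.mkQ) (by ext x; simp)

lemma submoduleShortComplex_shortExact {X : ModuleCat.{u} R} (N : Submodule R X) :
    (submoduleShortComplex N).ShortExact where
  exact := by
    rw [ShortComplex.moduleCat_exact_iff_range_eq_ker]
    simp
  mono_f := (ModuleCat.mono_iff_injective _).2 N.injective_subtype
  epi_g := (ModuleCat.epi_iff_surjective _).2 N.mkQ_surjective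

variable (R)

/-- Let `T` be a finitely generated module of projective dimension at most `1`
with `Gen(T) ⊆ Ker Ext¹_R(T, -)`, and suppose that the only module `X` with
`Hom_R(T, X) = 0` and `Ext¹_R(T, X) = 0` is `X = 0` (i.e. `T` is a large partial tilting
module of projective dimension at most `1`). Then `Gen(T) = Ker Ext¹_R(T, -)`,
that is, `T` is a tilting module. -/
theorem large_partial_tilting_pd_le_one_is_tilting (T : ModuleCat.{u} R)
    (hfg : Module.Finite R T)
    (hpd : ∀ (X : ModuleCat.{u} R) (i : ℕ), 1 < i → ExtVanish R T X i)
    (hpartial : ∀ X : ModuleCat.{u} R, InGen R T X → ExtVanish R T X 1)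
    (hlarge : ∀ X : ModuleCat.{u} R, (∀ f : T ⟶ X, f = 0) → ExtVanish R T X 1 →
      Subsingleton X) :
    ∀ X : ModuleCat.{u} R, InGen R T X ↔ ExtVanish R T X 1 := by
  refine fun X => ⟨hpartial X, fun hX => ?_⟩
  have hS := submoduleShortComplex_shortExact (traceSubmodule R T X)
  have hgen := inGen_traceSubmodule T X
  have hsub : Subsingleton (X ⧸ traceSubmodule R T X) := by
    refine hlarge (ModuleCat.of R (X ⧸ traceSubmodule R T X)) (fun f => ?_)
      (hS.extVanish_one_right hX (hpd _ 2 one_lt_two))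
    obtain ⟨f', rfl⟩ := hS.exists_lift_of_extVanish_one (hpartial _ hgen) f
    ext t
    exact (Submodule.Quotient.mk_eq_zero _).2 (hom_apply_mem_traceSubmodule f' t)
  rw [Submodule.Quotient.subsingleton_iff] at hsub
  refine hgen.of_surjective (ModuleCat.ofHom (traceSubmodule R T X).subtype) fun x => ?_
  exact ⟨⟨x, hsub ▸ Submodule.mem_top⟩, rfl⟩
end
end
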